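/- arXiv:2202.01588 — 2 statements merged into one kernel-verified Lean document; each statement's English description precedes it below -/
import Mathlib

section
/- (Pentagon relation with quantum data, quantum-plane form.) Let d be a positive integer and β₁, β₂ integers. In the completed quantum plane A_d (so Y₂Y₁ = v^{2d}·Y₁Y₂), the identity Ψ_{v^d}(v^{β₂}·Y₂) · Ψ_{v^d}(v^{β₁}·Y₁) = Ψ_{v^d}(v^{β₁}·Y₁) · Ψ_{v^d}(v^{β₁+β₂}·y^{(1,1)}) · Ψ_{v^d}(v^{β₂}·Y₂) holds, where y^{(1,1)} = v^d·Y₁Y₂. (This is the pentagon relation Ψ_{c,b₂}[n₂]Ψ_{c,b₁}[n₁] = Ψ_{c,b₁}[n₁]Ψ_{c,b₁+b₂}[n₁+n₂]Ψ_{c,b₂}[n₂] for quantum dilogarithm elements with {n₂,n₁} = c > 0, rendered faithfully in the quantum torus via the quantum y-representation.) -/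
noncomputable section

open Filter

abbrev K : Type := RatFunc ℚ

/-- The indeterminate generator `v` of `K = ℚ(v)`. -/
def v : K := RatFunc.X

/-- The completed quantum plane: formal series `Σ c_{m,n}·Y₁^m Y₂^n`, encoded as
coefficient functions `ℕ × ℕ → K`. -/
abbrev QP : Type := (ℕ × ℕ) → K

/-- The twisted product of the completed quantum plane `A_γ`:
`(Y₁^a Y₂^b)·(Y₁^{a'} Y₂^{b'}) = v^{2γba'}·Y₁^{a+a'} Y₂^{b+b'}`, extended bilinearly and
continuously for the coefficientwise topology. -/
def qmul (γ : ℕ) (F G : QP) : QP := fun p =>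
  ∑ a ∈ Finset.range (p.1 + 1), ∑ b ∈ Finset.range (p.2 + 1),
    v ^ (2 * γ * b * (p.1 - a)) * F (a, b) * G (p.1 - a, p.2 - b)

/-- The multiplicative unit of the completed quantum plane. -/
def qone : QP := fun p => if p = (0, 0) then 1 else 0

/-- Powers in the completed quantum plane. -/
def qpow (γ : ℕ) (Z : QP) : ℕ → QP
  | 0 => qone
  | k + 1 => qmul γ Z (qpow γ Z k)

/-- The element `v^β · y^{(m,n)} = v^{β + γmn} · Y₁^m Y₂^n` of `A_γ`
(`y^{(m,n)} := v^{γmn}·Y₁^m Y₂^n` is the normalized quantum monomial). -/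
def qy (γ : ℕ) (β : ℤ) (m n : ℕ) : QP := fun p =>
  if p = (m, n) then v ^ (β + (γ : ℤ) * (m : ℤ) * (n : ℤ)) else 0

/-- The series `Σ_{j≥1} ((−1)^{j+1}/(j·(w^j − w^{−j})))·Z^j` (for `Z` with zero
constant term, the coefficient at `(m,n)` only involves `j ≤ m + n`). -/
def qarg (γ : ℕ) (w : K) (Z : QP) : QP := fun r =>
  ∑ j ∈ Finset.Icc 1 (r.1 + r.2),
    ((-1 : K) ^ (j + 1) / ((j : K) * (w ^ j - w⁻¹ ^ j))) * qpow γ Z j r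

/-- The quantum dilogarithm `Ψ_w(Z) = exp(Σ_{j≥1} ((−1)^{j+1}/(j(w^j − w^{−j})))·Z^j)`
in `A_γ`, for `Z` with zero constant term. -/
def qPsi (γ : ℕ) (w : K) (Z : QP) : QP := fun p =>
  ∑ k ∈ Finset.range (p.1 + p.2 + 1),
    ((Nat.factorial k : K)⁻¹) * qpow γ (qarg γ w Z) k p

/-- The ordered product `→∏_{p=a..b} g_p = g_a g_{a+1} ⋯ g_b` in `A_γ`. -/
def qprodR (γ : ℕ) (g : ℕ → QP) (a b : ℕ) : QP :=
  ((List.range' a (b + 1 - a)).map g).foldr (qmul γ) qone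

/-- The ordered product `←∏_{p=a..b} g_p = g_b ⋯ g_{a+1} g_a` in `A_γ`. -/
def qprodL (γ : ℕ) (g : ℕ → QP) (a b : ℕ) : QP :=
  ((List.range' a (b + 1 - a)).reverse.map g).foldr (qmul γ) qone


open PowerSeries in
/-- A solution of a first-order linear differential equation vanishing at the origin is zero. -/
theorem PowerSeries.eq_zero_of_derivative_eq_mul {R : Type*} [Field R] [CharZero R]
    {M V : R⟦X⟧} (h : d⁄dX R V = M * V) (h0 : coeff 0 V = 0) : V = 0 := by
  ext n
  induction n using Nat.strong_induction_on with
  | _ n ih =>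
    cases n with
    | zero => simpa using h0
    | succ n =>
      have h1 := congrArg (coeff n) h
      rw [coeff_derivative, coeff_mul, Finset.sum_eq_zero] at h1
      · simpa [Nat.cast_add_one_ne_zero n] using h1
      · intro x hx
        rw [ih x.2 (by have := Finset.HasAntidiagonal.mem_antidiagonal.mp hx; omega)]
        simp

/-- The Cauchy product `∏_{i<k} (x - p^i)`. -/
def shiftedProd (p x : K) (k : ℕ) : K := ∏ i ∈ Finset.range k, (x - p ^ i)

/-- The reciprocal `∏_{i=1}^n (p^i - 1)⁻¹` of the `p`-factorial. -/
def invFact (p : K) (n : ℕ) : K := ∏ i ∈ Finset.range n, (p ^ (i + 1) - 1)⁻¹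

theorem invFact_succ (p : K) (hp : ∀ n : ℕ, p ^ (n + 1) - 1 ≠ 0) (n : ℕ) :
    (p ^ (n + 1) - 1) * invFact p (n + 1) = invFact p n := by
  rw [invFact, Finset.prod_range_succ, ← invFact, mul_comm, mul_assoc, inv_mul_cancel₀ (hp n),
    mul_one]

theorem sum_invFact_mul_shiftedProd (p : K) (hp : ∀ n : ℕ, p ^ (n + 1) - 1 ≠ 0) (x : K) (m : ℕ) :
    ∑ ij ∈ Finset.HasAntidiagonal.antidiagonal m, invFact p ij.1 * (invFact p ij.2 * shiftedProd p x ij.2)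
      = invFact p m * x ^ m := by
  induction m with
  | zero => simp [invFact, shiftedProd]
  | succ m ih =>
    apply mul_left_cancel₀ (hp m)
    rw [← mul_assoc, invFact_succ p hp, pow_succ x, ← mul_assoc, ← ih, Finset.mul_sum,
      Finset.sum_mul]
    have h : ∀ ij ∈ Finset.HasAntidiagonal.antidiagonal (m + 1), (p ^ (m + 1) - 1) *
        (invFact p ij.1 * (invFact p ij.2 * shiftedProd p x ij.2))
        = invFact p ij.1 * ((p ^ ij.2 - 1) * invFact p ij.2 * shiftedProd p x ij.2)
          + (p ^ ij.1 - 1) * invFact p ij.1 * p ^ ij.2 * (invFact p ij.2 * shiftedProd p x ij.2) := by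
      intro ij hij
      rw [← Finset.HasAntidiagonal.mem_antidiagonal.mp hij, pow_add]
      ring
    rw [Finset.sum_congr rfl h, Finset.sum_add_distrib, Finset.Nat.sum_antidiagonal_succ',
      Finset.Nat.sum_antidiagonal_succ (n := m)]
    simp only [invFact_succ p hp, pow_zero, sub_self, zero_mul, mul_zero, zero_add]
    rw [← Finset.sum_add_distrib]
    refine Finset.sum_congr rfl fun ij _ => ?_
    rw [shiftedProd, Finset.prod_range_succ, ← shiftedProd]
    ring

theorem invFact_mul_shiftedProd (p : K) (hp : ∀ n : ℕ, p ^ (n + 1) - 1 ≠ 0) {k n : ℕ}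
    (hk : k ≤ n) :
    invFact p n * shiftedProd p (p ^ n) k = p ^ (k.choose 2) * invFact p (n - k) := by
  induction k with
  | zero => simp [shiftedProd]
  | succ k ih =>
    obtain ⟨r, rfl⟩ := Nat.exists_eq_add_of_le hk
    have h1 := ih (by omega)
    rw [shiftedProd, Finset.prod_range_succ, ← shiftedProd, ← mul_assoc, h1,
      show k + 1 + r - (k + 1) = r by omega, show k + 1 + r - k = r + 1 by omega,
      ← invFact_succ p hp r, Nat.choose_succ_succ' k 1, Nat.choose_one_right]
    ring

theorem shiftedProd_eq_zero (p : K) {k n : ℕ} (hk : n < k) : shiftedProd p (p ^ n) k = 0 :=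
  Finset.prod_eq_zero (Finset.mem_range.mpr hk) (sub_self _)

theorem v_pow_ne_one {n : ℕ} (hn : 0 < n) : v ^ n ≠ 1 := by
  intro h
  have h1 : (Polynomial.X : Polynomial ℚ) ^ n = 1 := by
    apply RatFunc.algebraMap_injective ℚ
    simpa [v] using h
  have := congrArg Polynomial.natDegree h1
  simp at this
  omega

theorem v_ne_zero : v ≠ 0 := RatFunc.X_ne_zero

theorem qmul_sum_left (γ : ℕ) {ι : Type*} (s : Finset ι) (f : ι → K) (F : ι → QP) (G : QP)
    (p : ℕ × ℕ) :
    qmul γ (fun r => ∑ i ∈ s, f i * F i r) G p = ∑ i ∈ s, f i * qmul γ (F i) G p := by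
  simp only [qmul, Finset.mul_sum, Finset.sum_mul]
  rw [Finset.sum_comm]
  conv_rhs => rw [Finset.sum_comm]; enter [2, y]; rw [Finset.sum_comm]
  rw [Finset.sum_comm]
  refine Finset.sum_congr rfl fun a _ => Finset.sum_congr rfl fun b _ =>
    Finset.sum_congr rfl fun i _ => ?_
  ring

theorem qmul_sum_right (γ : ℕ) {ι : Type*} (s : Finset ι) (f : ι → K) (F : QP) (G : ι → QP)
    (p : ℕ × ℕ) :
    qmul γ F (fun r => ∑ i ∈ s, f i * G i r) p = ∑ i ∈ s, f i * qmul γ F (G i) p := by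
  simp only [qmul, Finset.mul_sum]
  conv_rhs => rw [Finset.sum_comm]; enter [2, y]; rw [Finset.sum_comm]
  refine Finset.sum_congr rfl fun a _ => Finset.sum_congr rfl fun b _ =>
    Finset.sum_congr rfl fun i _ => ?_
  ring

theorem qmul_congr (γ : ℕ) {F F' G G' : QP} (p : ℕ × ℕ) (hF : ∀ r ≤ p, F r = F' r)
    (hG : ∀ r ≤ p, G r = G' r) : qmul γ F G p = qmul γ F' G' p := by
  refine Finset.sum_congr rfl fun a ha => Finset.sum_congr rfl fun b hb => ?_
  rw [Finset.mem_range] at ha hb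
  rw [hF (a, b) ⟨by simp; omega, by simp; omega⟩, hG _ ⟨by simp, by simp⟩]

theorem qmul_qy (γ : ℕ) (β β' : ℤ) (m n m' n' : ℕ) (p : ℕ × ℕ) :
    qmul γ (qy γ β m n) (qy γ β' m' n') p
      = v ^ ((γ : ℤ) * (n * m' - m * n')) * qy γ (β + β') (m + m') (n + n') p := by
  obtain ⟨p1, p2⟩ := p
  have h : ∀ a b, v ^ (2 * γ * b * (p1 - a)) * qy γ β m n (a, b) * qy γ β' m' n' (p1 - a, p2 - b)
      = if a = m then if b = n then v ^ (2 * γ * n * (p1 - m)) *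
        v ^ (β + (γ : ℤ) * (m : ℤ) * (n : ℤ)) * qy γ β' m' n' (p1 - m, p2 - n) else 0 else 0 := by
    intro a b
    by_cases ha : a = m <;> by_cases hb : b = n <;> simp [qy, ha, hb]
  simp only [qmul, h, Finset.sum_ite_irrel, Finset.sum_ite_eq', Finset.mem_range,
    Finset.sum_const_zero]
  by_cases hp : p1 = m + m' ∧ p2 = n + n'
  · obtain ⟨rfl, rfl⟩ := hp
    simp only [show m < m + m' + 1 by omega, show n < n + n' + 1 by omega, if_true, qy,
      Nat.add_sub_cancel_left]
    rw [← zpow_natCast, ← zpow_add₀ v_ne_zero, ← zpow_add₀ v_ne_zero, ← zpow_add₀ v_ne_zero]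
    congr 1
    push_cast
    ring
  · have : qy γ (β + β') (m + m') (n + n') (p1, p2) = 0 := by simp [qy, hp]
    rw [this, mul_zero]
    by_cases h1 : m < p1 + 1 <;> by_cases h2 : n < p2 + 1 <;> simp [h1, h2, qy]
    intro; omega

theorem mul_self_eq_two_mul_choose_two_add (j : ℕ) : j * j = 2 * j.choose 2 + j := by
  induction j with
  | zero => rfl
  | succ j ih =>
    rw [Nat.choose_succ_succ' j 1, Nat.choose_one_right]
    linarith

open PowerSeries in
/-- The substitution of `v^β · y^{(a,b)}` for the variable of a power series. -/
def ofPS (γ : ℕ) (β : ℤ) (a b : ℕ) (f : K⟦X⟧) : QP := fun p =>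
  ∑ j ∈ Finset.range (p.1 + p.2 + 1), coeff j f * qy γ (j * β) (j * a) (j * b) p

theorem qy_mul_eq_zero (γ : ℕ) (β : ℤ) {a b : ℕ} (hab : 0 < a + b) {j : ℕ} {p : ℕ × ℕ}
    (hj : p.1 + p.2 < j) : qy γ β (j * a) (j * b) p = 0 := by
  rw [qy, if_neg]
  rintro rfl
  have : j * 1 ≤ j * (a + b) := Nat.mul_le_mul_left j hab
  rw [mul_add] at this
  simp only at hj
  omega

open PowerSeries in
theorem ofPS_eq_sum (γ : ℕ) (β : ℤ) {a b : ℕ} (hab : 0 < a + b) (f : K⟦X⟧) {p : ℕ × ℕ} {N : ℕ}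
    (hN : p.1 + p.2 < N) :
    ofPS γ β a b f p = ∑ j ∈ Finset.range N, coeff j f * qy γ (j * β) (j * a) (j * b) p := by
  refine Finset.sum_subset (Finset.range_subset_range.mpr hN) fun j _ hj => ?_
  rw [qy_mul_eq_zero γ _ hab (by simpa using hj), mul_zero]

open PowerSeries in
theorem qmul_ofPS (γ : ℕ) (β : ℤ) {a b : ℕ} (hab : 0 < a + b) (f g : K⟦X⟧) :
    qmul γ (ofPS γ β a b f) (ofPS γ β a b g) = ofPS γ β a b (f * g) := by
  funext p
  set N := p.1 + p.2 + 1 with hN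
  have hr : ∀ r ≤ p, r.1 + r.2 < N := fun r hr => by
    have := hr.1
    have := hr.2
    omega
  rw [qmul_congr γ p (fun r h => ofPS_eq_sum γ β hab f (hr r h))
    (fun r h => ofPS_eq_sum γ β hab g (hr r h)), qmul_sum_left]
  simp only [qmul_sum_right, qmul_qy]
  have hqy : ∀ i j : ℕ, v ^ ((γ : ℤ) * (((i * b : ℕ) : ℤ) * ((j * a : ℕ) : ℤ)
        - ((i * a : ℕ) : ℤ) * ((j * b : ℕ) : ℤ)))
      * qy γ (i * β + j * β) (i * a + j * a) (i * b + j * b) p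
      = qy γ ((i + j : ℕ) * β) ((i + j) * a) ((i + j) * b) p := by
    intro i j
    rw [show ((γ : ℤ) * (((i * b : ℕ) : ℤ) * ((j * a : ℕ) : ℤ)
        - ((i * a : ℕ) : ℤ) * ((j * b : ℕ) : ℤ))) = 0 by push_cast; ring, zpow_zero, one_mul]
    simp only [add_mul, Nat.cast_add]
  simp only [hqy, ofPS, coeff_mul, Finset.sum_mul, Finset.mul_sum]
  rw [← Finset.sum_product', Finset.sum_sigma']
  symm
  refine Finset.sum_of_injOn (fun x => x.2) ?_ ?_ ?_ ?_
  · rintro ⟨n, x⟩ h ⟨n', x'⟩ h' (rfl : x = x')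
    simp only [Finset.coe_sigma, Set.mem_sigma_iff, Finset.mem_coe,
      Finset.HasAntidiagonal.mem_antidiagonal] at h h'
    obtain ⟨_, rfl⟩ := h
    obtain ⟨_, rfl⟩ := h'
    rfl
  · rintro ⟨n, x⟩ h
    simp only [Finset.coe_sigma, Set.mem_sigma_iff, Finset.mem_coe, Finset.mem_range,
      Finset.HasAntidiagonal.mem_antidiagonal] at h
    simp only [Finset.coe_product, Set.mem_prod, Finset.mem_coe, Finset.mem_range]
    omega
  · rintro x hx hx'
    rw [qy_mul_eq_zero γ _ hab, mul_zero, mul_zero]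
    by_contra hlt
    exact hx' ⟨⟨x.1 + x.2, x⟩, by simp; omega, rfl⟩
  · rintro ⟨n, x⟩ h
    simp only [Finset.mem_sigma, Finset.HasAntidiagonal.mem_antidiagonal] at h
    obtain ⟨_, rfl⟩ := h
    ring

open PowerSeries in
theorem ofPS_X_pow (γ : ℕ) (β : ℤ) {a b : ℕ} (hab : 0 < a + b) (k : ℕ) :
    ofPS γ β a b (X ^ k) = qy γ (k * β) (k * a) (k * b) := by
  funext p
  rw [ofPS_eq_sum γ β hab _ (N := p.1 + p.2 + 1 + k) (by omega)]
  simp only [coeff_X_pow, ite_mul, one_mul, zero_mul, Finset.sum_ite_eq', Finset.mem_range]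
  rw [if_pos (by omega)]

open PowerSeries in
theorem qpow_ofPS (γ : ℕ) (β : ℤ) {a b : ℕ} (hab : 0 < a + b) (f : K⟦X⟧) (k : ℕ) :
    qpow γ (ofPS γ β a b f) k = ofPS γ β a b (f ^ k) := by
  induction k with
  | zero =>
    funext p
    rw [pow_zero, ← pow_zero X, ofPS_X_pow γ β hab]
    simp [qpow, qone, qy]
  | succ k ih => rw [qpow, ih, qmul_ofPS γ β hab, pow_succ']

theorem qpow_qy (γ : ℕ) (β : ℤ) {a b : ℕ} (hab : 0 < a + b) (k : ℕ) :
    qpow γ (qy γ β a b) k = qy γ (k * β) (k * a) (k * b) := by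
  have h := ofPS_X_pow γ β hab 1
  simp only [Nat.cast_one, one_mul] at h
  rw [← h, qpow_ofPS γ β hab, pow_one, ofPS_X_pow γ β hab]

open PowerSeries in
/-- The logarithm of the quantum dilogarithm as a power series. -/
def logDilog (w : K) : K⟦X⟧ :=
  mk fun j => (-1 : K) ^ (j + 1) / ((j : K) * (w ^ j - w⁻¹ ^ j))

open PowerSeries in
/-- The quantum dilogarithm as a power series. -/
def dilog (w : K) : K⟦X⟧ := (exp K).subst (logDilog w)

open PowerSeries in
theorem constantCoeff_logDilog (w : K) : constantCoeff (logDilog w) = 0 := by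
  rw [← coeff_zero_eq_constantCoeff_apply, logDilog, coeff_mk]
  simp

open PowerSeries in
theorem coeff_dilog (w : K) {n N : ℕ} (hN : n < N) :
    coeff n (dilog w)
      = ∑ k ∈ Finset.range N, (Nat.factorial k : K)⁻¹ * coeff n (logDilog w ^ k) := by
  rw [dilog, coeff_subst' (HasSubst.of_constantCoeff_zero' (constantCoeff_logDilog w)),
    finsum_eq_sum_of_support_subset (s := Finset.range N)]
  · simp
  · intro k hk
    by_contra hkN
    refine hk ?_
    simp only [Finset.coe_range, Set.mem_Iio, not_lt] at hkN
    simp only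
    rw [coeff_of_lt_order (φ := logDilog w ^ k), smul_zero]
    exact lt_of_lt_of_le (by exact_mod_cast lt_of_lt_of_le hN hkN)
      (le_order_pow_of_constantCoeff_eq_zero k (constantCoeff_logDilog w))

theorem qarg_qy (γ : ℕ) (w : K) (β : ℤ) {a b : ℕ} (hab : 0 < a + b) :
    qarg γ w (qy γ β a b) = ofPS γ β a b (logDilog w) := by
  funext p
  simp only [qarg, ofPS, qpow_qy γ β hab, logDilog, PowerSeries.coeff_mk]
  refine Finset.sum_subset (fun j hj => ?_) fun j hj hj' => ?_
  · simp only [Finset.mem_Icc, Finset.mem_range] at *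
    omega
  · obtain rfl : j = 0 := by
      simp only [Finset.mem_Icc, Finset.mem_range] at *
      omega
    simp

theorem qPsi_qy (γ : ℕ) (w : K) (β : ℤ) {a b : ℕ} (hab : 0 < a + b) :
    qPsi γ w (qy γ β a b) = ofPS γ β a b (dilog w) := by
  funext p
  simp only [qPsi, qarg_qy γ w β hab, qpow_ofPS γ β hab, ofPS, Finset.mul_sum]
  rw [Finset.sum_comm]
  refine Finset.sum_congr rfl fun j hj => ?_
  rw [coeff_dilog w (Finset.mem_range.mp hj), Finset.sum_mul]
  exact Finset.sum_congr rfl fun k _ => by ring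

open PowerSeries in
theorem derivative_rescale {R : Type*} [CommSemiring R] (c : R) (f : R⟦X⟧) :
    d⁄dX R (rescale c f) = C c * rescale c (d⁄dX R f) := by
  ext n
  simp only [coeff_derivative, coeff_rescale, coeff_C_mul]
  ring

open PowerSeries in
theorem derivative_dilog (w : K) : d⁄dX K (dilog w) = dilog w * d⁄dX K (logDilog w) := by
  rw [dilog, derivative_subst (HasSubst.of_constantCoeff_zero' (constantCoeff_logDilog w)),
    derivative_exp]

open PowerSeries in
theorem derivative_logDilog_functional (w : K) (hw : w ≠ 0)
    (hp : ∀ n : ℕ, (w ^ 2) ^ (n + 1) - 1 ≠ 0) :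
    (1 + C w * X) * (C (w ^ 2) * rescale (w ^ 2) (d⁄dX K (logDilog w)) - d⁄dX K (logDilog w))
      = C w := by
  have h : C (w ^ 2) * rescale (w ^ 2) (d⁄dX K (logDilog w)) - d⁄dX K (logDilog w)
      = mk fun n => w * (-w) ^ n := by
    ext n
    simp only [map_sub, coeff_C_mul, coeff_rescale, coeff_derivative, logDilog, coeff_mk]
    have h1 : (n : K) + 1 ≠ 0 := Nat.cast_add_one_ne_zero n
    have h2 := hp n
    have h3 : w ^ (n + 1) - w⁻¹ ^ (n + 1) = ((w ^ 2) ^ (n + 1) - 1) / w ^ (n + 1) := by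
      rw [inv_pow]
      field_simp
      ring
    rw [h3]
    push_cast
    field_simp
    rw [neg_pow w n]
    ring
  rw [h]
  ext n
  rw [add_mul, one_mul, mul_assoc, map_add, coeff_C_mul, coeff_C, coeff_mk]
  cases n with
  | zero => simp
  | succ n =>
    rw [coeff_succ_X_mul, coeff_mk, if_neg (Nat.succ_ne_zero n)]
    ring

open PowerSeries in
theorem coeff_zero_dilog (w : K) : coeff 0 (dilog w) = 1 := by
  rw [coeff_dilog w (N := 1) zero_lt_one]
  simp

open PowerSeries in
theorem rescale_dilog (w : K) (hw : w ≠ 0) (hp : ∀ n : ℕ, (w ^ 2) ^ (n + 1) - 1 ≠ 0) :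
    rescale (w ^ 2) (dilog w) = (1 + C w * X) * dilog w := by
  have hA : (1 + C w * X : K⟦X⟧) * (1 + C w * X)⁻¹ = 1 :=
    PowerSeries.mul_inv_cancel _ (by simp)
  rw [← sub_eq_zero]
  refine eq_zero_of_derivative_eq_mul
    (M := d⁄dX K (logDilog w) + C w * (1 + C w * X)⁻¹) ?_ ?_
  · have h := derivative_logDilog_functional w hw hp
    have hX : d⁄dX K (1 + C w * X : K⟦X⟧) = C w := by
      ext n
      cases n <;> simp [coeff_C]
    rw [map_sub, derivative_rescale, derivative_dilog, map_mul, Derivation.leibniz,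
      derivative_dilog, hX, smul_eq_mul, smul_eq_mul]
    linear_combination (1 + C w * X)⁻¹ * rescale (w ^ 2) (dilog w) * h
      + (dilog w * C w - rescale (w ^ 2) (dilog w) * (C (w ^ 2) *
        rescale (w ^ 2) (d⁄dX K (logDilog w)) - d⁄dX K (logDilog w))) * hA
  · rw [map_sub, coeff_rescale, add_mul, one_mul, mul_assoc, map_add, coeff_C_mul,
      coeff_zero_X_mul]
    simp

open PowerSeries in
theorem coeff_dilog_eq (w : K) (hw : w ≠ 0) (hp : ∀ n : ℕ, (w ^ 2) ^ (n + 1) - 1 ≠ 0) (n : ℕ) :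
    coeff n (dilog w) = w ^ n * invFact (w ^ 2) n := by
  induction n with
  | zero => simp [coeff_zero_dilog, invFact]
  | succ n ih =>
    have h := congrArg (coeff (n + 1)) (rescale_dilog w hw hp)
    rw [coeff_rescale, add_mul, one_mul, mul_assoc, map_add, coeff_C_mul, coeff_succ_X_mul,
      ih] at h
    apply mul_left_cancel₀ (hp n)
    linear_combination h - w ^ (n + 1) * invFact_succ (w ^ 2) hp n

open PowerSeries in
theorem ofPS_apply (γ : ℕ) (β : ℤ) {a b : ℕ} (hab : 0 < a + b) (f : K⟦X⟧) (k : ℕ) :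
    ofPS γ β a b f (k * a, k * b) = coeff k f * v ^ (k * β + γ * (k * a) * (k * b)) := by
  rw [ofPS_eq_sum γ β hab f (N := k * a + k * b + k + 1) (by simp only; omega),
    Finset.sum_eq_single k]
  · simp [qy]
  · intro j _ hj
    rw [qy, if_neg, mul_zero]
    intro h
    simp only [Prod.mk.injEq] at h
    rcases (by omega : 0 < a ∨ 0 < b) with h0 | h0
    · exact hj (Nat.eq_of_mul_eq_mul_right h0 h.1).symm
    · exact hj (Nat.eq_of_mul_eq_mul_right h0 h.2).symm
  · simp

theorem ofPS_eq_zero (γ : ℕ) (β : ℤ) {a b : ℕ} (f : PowerSeries K) {p : ℕ × ℕ}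
    (hp : ∀ k, p ≠ (k * a, k * b)) : ofPS γ β a b f p = 0 :=
  Finset.sum_eq_zero fun j _ => by rw [qy, if_neg (hp j), mul_zero]

open PowerSeries in
theorem ofPS_one_zero (γ : ℕ) (β : ℤ) (f : K⟦X⟧) (x y : ℕ) :
    ofPS γ β 1 0 f (x, y) = if y = 0 then coeff x f * v ^ (x * β) else 0 := by
  split_ifs with h
  · subst h
    simpa using ofPS_apply γ β (a := 1) (b := 0) zero_lt_one f x
  · exact ofPS_eq_zero γ β f (by simp [h])

open PowerSeries in
theorem ofPS_zero_one (γ : ℕ) (β : ℤ) (f : K⟦X⟧) (x y : ℕ) :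
    ofPS γ β 0 1 f (x, y) = if x = 0 then coeff y f * v ^ (y * β) else 0 := by
  split_ifs with h
  · subst h
    simpa using ofPS_apply γ β (a := 0) (b := 1) zero_lt_one f y
  · exact ofPS_eq_zero γ β f (by simp [h])

open PowerSeries in
theorem ofPS_one_one (γ : ℕ) (β : ℤ) (f : K⟦X⟧) (x y : ℕ) :
    ofPS γ β 1 1 f (x, y) = if y = x then coeff x f * v ^ (x * β + γ * x * x) else 0 := by
  split_ifs with h
  · subst h
    simpa using ofPS_apply γ β (a := 1) (b := 1) zero_lt_two f y
  · exact ofPS_eq_zero γ β f (by simp; omega)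

open PowerSeries in
theorem qmul_ofPS_one_zero (γ : ℕ) (β : ℤ) (f : K⟦X⟧) (G : QP) (m n : ℕ) :
    qmul γ (ofPS γ β 1 0 f) G (m, n)
      = ∑ ij ∈ Finset.HasAntidiagonal.antidiagonal m,
          coeff ij.1 f * v ^ (ij.1 * β) * G (ij.2, n) := by
  rw [Finset.Nat.sum_antidiagonal_eq_sum_range_succ_mk]
  simp only [qmul, ofPS_one_zero]
  refine Finset.sum_congr rfl fun x _ => ?_
  rw [Finset.sum_eq_single 0] <;> simp +contextual

open PowerSeries in
theorem qmul_ofPS_one_one_ofPS_zero_one (γ : ℕ) (β β' : ℤ) (f g : K⟦X⟧) (m n : ℕ) :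
    qmul γ (ofPS γ β 1 1 f) (ofPS γ β' 0 1 g) (m, n)
      = if m ≤ n then coeff m f * v ^ (m * β + γ * m * m)
          * (coeff (n - m) g * v ^ ((n - m : ℕ) * β')) else 0 := by
  simp only [qmul, ofPS_one_one, ofPS_zero_one]
  rw [Finset.sum_eq_single m]
  · simp
  · intro x hx hxm
    rw [Finset.mem_range] at hx
    simp [show m - x ≠ 0 by omega]
  · simp

open PowerSeries in
theorem qmul_ofPS_zero_one_ofPS_one_zero (γ : ℕ) (β β' : ℤ) (f g : K⟦X⟧) (m n : ℕ) :
    qmul γ (ofPS γ β 0 1 f) (ofPS γ β' 1 0 g) (m, n)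
      = v ^ (2 * γ * n * m) * (coeff n f * v ^ (n * β)) * (coeff m g * v ^ (m * β')) := by
  simp only [qmul, ofPS_one_zero, ofPS_zero_one]
  rw [Finset.sum_eq_single 0, Finset.sum_eq_single n]
  · simp
  · intro y hy hyn
    rw [Finset.mem_range] at hy
    simp [show n - y ≠ 0 by omega]
  · simp
  · simp +contextual
  · simp

/-- pentagon relation with quantum data, quantum-plane form:
in `A_d`, `Ψ_{v^d}(v^{β₂}Y₂)·Ψ_{v^d}(v^{β₁}Y₁)
= Ψ_{v^d}(v^{β₁}Y₁)·Ψ_{v^d}(v^{β₁+β₂}y^{(1,1)})·Ψ_{v^d}(v^{β₂}Y₂)`. -/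
theorem pentagon_relation (d : ℕ) (hd : 0 < d) (β₁ β₂ : ℤ) :
    qmul d (qPsi d (v ^ d) (qy d β₂ 0 1)) (qPsi d (v ^ d) (qy d β₁ 1 0))
      = qmul d (qPsi d (v ^ d) (qy d β₁ 1 0))
          (qmul d (qPsi d (v ^ d) (qy d (β₁ + β₂) 1 1))
            (qPsi d (v ^ d) (qy d β₂ 0 1))) := by
  have hq : v ^ d ≠ 0 := pow_ne_zero _ v_ne_zero
  have hp : ∀ n : ℕ, ((v ^ d) ^ 2) ^ (n + 1) - 1 ≠ 0 := fun n => by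
    rw [← pow_mul, ← pow_mul, sub_ne_zero]
    exact v_pow_ne_one (by positivity)
  simp only [qPsi_qy d (v ^ d) _ (show 0 < 0 + 1 by simp),
    qPsi_qy d (v ^ d) _ (show 0 < 1 + 0 by simp), qPsi_qy d (v ^ d) _ (show 0 < 1 + 1 by simp)]
  funext ⟨m, n⟩
  simp only [qmul_ofPS_one_zero, qmul_ofPS_one_one_ofPS_zero_one,
    qmul_ofPS_zero_one_ofPS_one_zero, coeff_dilog_eq _ hq hp]
  trans ((v ^ d) ^ (m + n) * v ^ (m * β₁ + n * β₂) * invFact ((v ^ d) ^ 2) n)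
    * (invFact ((v ^ d) ^ 2) m * (((v ^ d) ^ 2) ^ n) ^ m)
  · rw [zpow_add₀ v_ne_zero]
    ring
  · rw [← sum_invFact_mul_shiftedProd _ hp, Finset.mul_sum]
    refine Finset.sum_congr rfl fun ij hij => ?_
    obtain ⟨i, j⟩ := ij
    obtain rfl := Finset.HasAntidiagonal.mem_antidiagonal.mp hij
    simp only
    split_ifs with hj
    · obtain ⟨r, rfl⟩ := Nat.exists_eq_add_of_le hj
      have h := invFact_mul_shiftedProd _ hp hj
      have hv : v ^ ((j : ℤ) * (β₁ + β₂) + d * j * j)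
          = v ^ (j * β₁) * v ^ (j * β₂) * ((v ^ d) ^ 2) ^ j.choose 2 * (v ^ d) ^ j := by
        rw [zpow_add₀ v_ne_zero, mul_add, zpow_add₀ v_ne_zero, mul_assoc _ (_ ^ _) ((v ^ d) ^ j),
          ← pow_mul, ← pow_add, ← mul_self_eq_two_mul_choose_two_add, ← pow_mul, ← zpow_natCast v (d * _)]
        push_cast
        rw [mul_assoc (d : ℤ)]
      rw [Nat.add_sub_cancel_left] at h ⊢
      rw [hv]
      push_cast
      simp only [add_mul, zpow_add₀ v_ne_zero]
      linear_combination ((v ^ d) ^ (i + j + (j + r)) * (v ^ (i * β₁) * v ^ (j * β₁)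
        * (v ^ (j * β₂) * v ^ (r * β₂))) * invFact ((v ^ d) ^ 2) i * invFact ((v ^ d) ^ 2) j) * h
    · rw [shiftedProd_eq_zero _ (not_le.mp hj)]
      ring
end
end

section
/- (Consistency relation of the rank-2 quantum cluster scattering diagram of type G₂.) In the completed quantum plane A₃ (so Y₂Y₁ = v⁶·Y₁Y₂, with v playing the role of q^{1/3}), the identity Ψ_v(Y₂) · Ψ_{v³}(Y₁) = Ψ_{v³}(Y₁) · Ψ_v(y^{(1,1)}) · Ψ_{v³}(y^{(2,3)}) · Ψ_v(y^{(1,2)}) · Ψ_{v³}(y^{(1,3)}) · Ψ_v(Y₂) holds, where y^{(1,1)} = v³·Y₁Y₂, y^{(2,3)} = v^{18}·Y₁²Y₂³, y^{(1,2)} = v⁶·Y₁Y₂², and y^{(1,3)} = v⁹·Y₁Y₂³. (This is the relation Ψ_{1/3}[e₂]Ψ_{1}[e₁] = Ψ_{1}[e₁]Ψ_{1/3}[(1,1)]Ψ_{1}[(2,3)]Ψ_{1/3}[(1,2)]Ψ_{1}[(1,3)]Ψ_{1/3}[(0,1)] for the type G₂ QCSD with (δ₁,δ₂) = (1,3), rendered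 in the quantum torus.) -/
noncomputable section

open Filter

/-- The logarithm of the quantum dilogarithm, as a power series in one variable. -/
def qlogSeries (w : K) : PowerSeries K :=
  PowerSeries.mk fun j => (-1 : K) ^ (j + 1) / ((j : K) * (w ^ j - w⁻¹ ^ j))

/-- The quantum dilogarithm, as a power series in one variable. -/
def qdilogSeries (w : K) : PowerSeries K :=
  (PowerSeries.exp K).subst (qlogSeries w)

theorem constantCoeff_qlogSeries (w : K) : PowerSeries.constantCoeff (qlogSeries w) = 0 := by
  rw [← PowerSeries.coeff_zero_eq_constantCoeff_apply, qlogSeries, PowerSeries.coeff_mk]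
  simp

theorem coeff_pow_eq_zero_of_lt {g : PowerSeries K} (hg : PowerSeries.constantCoeff g = 0)
    {i k : ℕ} (h : i < k) : PowerSeries.coeff i (g ^ k) = 0 :=
  PowerSeries.X_pow_dvd_iff.1 (pow_dvd_pow_of_dvd (PowerSeries.X_dvd_iff.2 hg) k) i h

theorem coeff_qdilogSeries (w : K) {i N : ℕ} (h : i < N) :
    PowerSeries.coeff i (qdilogSeries w)
      = ∑ k ∈ Finset.range N, (Nat.factorial k : K)⁻¹ * PowerSeries.coeff i (qlogSeries w ^ k) := by
  rw [qdilogSeries, PowerSeries.coeff_subst'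
    (PowerSeries.HasSubst.of_constantCoeff_zero' (constantCoeff_qlogSeries w)),
    finsum_eq_sum_of_support_subset (s := Finset.range N)]
  · simp [PowerSeries.coeff_exp]
  · intro k hk
    by_contra hk'
    simp only [Finset.coe_range, Set.mem_Iio, not_lt] at hk'
    exact hk (by
      simp only [coeff_pow_eq_zero_of_lt (constantCoeff_qlogSeries w) (h.trans_le hk'), smul_zero])

theorem constantCoeff_qdilogSeries (w : K) : PowerSeries.constantCoeff (qdilogSeries w) = 1 := by
  rw [← PowerSeries.coeff_zero_eq_constantCoeff_apply, coeff_qdilogSeries w Nat.zero_lt_one]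
  simp

open PowerSeries in
theorem derivative_rescale_s6 (c : K) (f : PowerSeries K) :
    derivative K (rescale c f) = C c * rescale c (derivative K f) := by
  ext n
  rw [coeff_derivative, coeff_rescale, coeff_C_mul, coeff_rescale, coeff_derivative]
  ring

open PowerSeries in
theorem eq_of_derivative_eq_mul {u f g : PowerSeries K} (hf : derivative K f = u * f)
    (hg : derivative K g = u * g) (h0 : constantCoeff f = constantCoeff g) : f = g := by
  rw [← sub_eq_zero]
  have hd : derivative K (f - g) = u * (f - g) := by rw [map_sub, hf, hg, mul_sub]
  have hd0 : constantCoeff (f - g) = 0 := by rw [map_sub, h0, sub_self]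
  generalize f - g = d at hd hd0
  ext n
  induction n using Nat.strong_induction_on with
  | _ n ih =>
    cases n with
    | zero => simpa using hd0
    | succ n =>
      have h := congrArg (coeff n) hd
      rw [coeff_derivative, coeff_mul, Finset.sum_eq_zero] at h
      · have hn : (n : K) + 1 ≠ 0 := by exact_mod_cast n.succ_ne_zero
        simpa using (mul_eq_zero.1 h).resolve_right hn
      · intro s hs
        rw [Finset.HasAntidiagonal.mem_antidiagonal] at hs
        rw [ih s.2 (by omega)]
        simp

open PowerSeries in
theorem rescale_derivative_qlogSeries {w : K} (hw : ∀ j : ℕ, 0 < j → w ^ j - w⁻¹ ^ j ≠ 0) :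
    (1 + C w * X) * (C (w ^ 2) * rescale (w ^ 2) (derivative K (qlogSeries w))
      - derivative K (qlogSeries w)) = C w := by
  have hw0 : w ≠ 0 := by
    rintro rfl
    exact hw 1 one_pos (by simp)
  have h : C (w ^ 2) * rescale (w ^ 2) (derivative K (qlogSeries w)) - derivative K (qlogSeries w)
      = mk fun j => w * (-w) ^ j := by
    ext j
    have hj : (j : K) + 1 ≠ 0 := by exact_mod_cast j.succ_ne_zero
    have hwj := hw (j + 1) j.succ_pos
    rw [map_sub, coeff_C_mul, coeff_rescale, coeff_derivative, qlogSeries, coeff_mk, coeff_mk,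
      Nat.cast_add, Nat.cast_one, neg_pow w]
    have h1 : w ^ (j + 1) * w⁻¹ ^ (j + 1) = 1 := by rw [← mul_pow, mul_inv_cancel₀ hw0, one_pow]
    generalize w⁻¹ ^ (j + 1) = t at *
    have h2 : (-1 : K) ^ (j + 1 + 1) / (((j : K) + 1) * (w ^ (j + 1) - t)) * ((j : K) + 1)
        = (-1) ^ j / (w ^ (j + 1) - t) := by
      field_simp
      ring
    have h3 : (-1 : K) ^ j / (w ^ (j + 1) - t) * (w ^ (j + 1) - t) = (-1) ^ j :=
      div_mul_cancel₀ _ hwj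
    rw [h2]
    generalize (-1 : K) ^ j / (w ^ (j + 1) - t) = q at *
    linear_combination w ^ (j + 1) * h3 + q * h1
  rw [h]
  ext n
  rw [add_mul, one_mul, map_add, coeff_mk, mul_assoc, coeff_C_mul]
  cases n with
  | zero => simp
  | succ n =>
    rw [coeff_succ_X_mul, coeff_mk, coeff_C, if_neg n.succ_ne_zero]
    ring

open PowerSeries in
theorem rescale_qdilogSeries {w : K} (hw : ∀ j : ℕ, 0 < j → w ^ j - w⁻¹ ^ j ≠ 0) :
    rescale (w ^ 2) (qdilogSeries w) = (1 + C w * X) * qdilogSeries w := by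
  have hd : derivative K (qdilogSeries w)
      = derivative K (qlogSeries w) * qdilogSeries w := by
    rw [qdilogSeries, derivative_subst
      (HasSubst.of_constantCoeff_zero' (constantCoeff_qlogSeries w)), derivative_exp, mul_comm]
  refine eq_of_derivative_eq_mul
    (u := C (w ^ 2) * rescale (w ^ 2) (derivative K (qlogSeries w))) ?_ ?_ ?_
  · rw [derivative_rescale_s6, hd, map_mul, mul_assoc]
  · have h1 : derivative K (1 + C w * X : PowerSeries K) = C w := by
      simp [Derivation.leibniz]
    rw [Derivation.leibniz, h1, hd, smul_eq_mul, smul_eq_mul]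
    linear_combination (-qdilogSeries w) * rescale_derivative_qlogSeries hw
  · rw [map_mul, ← coeff_zero_eq_constantCoeff_apply, coeff_rescale]
    simp

open PowerSeries in
theorem rescale_mul_sq_qdilogSeries {w : K} (hw : ∀ j : ℕ, 0 < j → w ^ j - w⁻¹ ^ j ≠ 0) (c : K) :
    rescale (c * w ^ 2) (qdilogSeries w)
      = (1 + C (c * w) * X) * rescale c (qdilogSeries w) := by
  rw [mul_comm c, rescale_mul, RingHom.comp_apply, rescale_qdilogSeries hw]
  have h : rescale c (C w) = C w := by
    ext n
    rw [coeff_rescale, coeff_C]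
    split_ifs with h <;> simp [h]
  rw [map_mul, map_add, map_one, map_mul, h, rescale_X, map_mul]
  ring

/-- The completed quantum plane `A_γ` as a type carrying its twisted ring structure. -/
def QPlane (_γ : ℕ) : Type := QP

namespace QPlane

open Finset

variable {γ : ℕ}

instance : AddCommGroup (QPlane γ) := inferInstanceAs (AddCommGroup (ℕ × ℕ → K))
instance : Module K (QPlane γ) := inferInstanceAs (Module K (ℕ × ℕ → K))
instance : Mul (QPlane γ) := ⟨qmul γ⟩
instance : One (QPlane γ) := ⟨qone⟩

@[ext] theorem ext {F G : QPlane γ} (h : ∀ m n, F (m, n) = G (m, n)) : F = G :=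
  funext fun p => h p.1 p.2

@[simp] theorem add_apply (F G : QPlane γ) (p : ℕ × ℕ) : (F + G) p = F p + G p := rfl
@[simp] theorem sub_apply (F G : QPlane γ) (p : ℕ × ℕ) : (F - G) p = F p - G p := rfl
@[simp] theorem zero_apply (p : ℕ × ℕ) : (0 : QPlane γ) p = 0 := rfl
@[simp] theorem smul_apply (c : K) (F : QPlane γ) (p : ℕ × ℕ) : (c • F) p = c * F p := rfl

theorem one_apply (p : ℕ × ℕ) : (1 : QPlane γ) p = if p = (0, 0) then 1 else 0 := rfl

theorem sum_apply {ι : Type*} (s : Finset ι) (f : ι → QPlane γ) (p : ℕ × ℕ) :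
    (∑ i ∈ s, f i) p = ∑ i ∈ s, f i p :=
  Finset.sum_apply p s f

theorem mul_apply (F G : QPlane γ) (m n : ℕ) :
    (F * G) (m, n) = ∑ s ∈ antidiagonal m, ∑ t ∈ antidiagonal n,
      v ^ (2 * γ * t.1 * s.2) * F (s.1, t.1) * G (s.2, t.2) := by
  simp only [Nat.sum_antidiagonal_eq_sum_range_succ_mk]
  rfl

theorem sum_antidiagonal_assoc {M : Type*} [AddCommMonoid M] (f : ℕ → ℕ → ℕ → M) (n : ℕ) :
    ∑ s ∈ antidiagonal n, ∑ t ∈ antidiagonal s.1, f t.1 t.2 s.2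
      = ∑ s ∈ antidiagonal n, ∑ t ∈ antidiagonal s.2, f s.1 t.1 t.2 := by
  simp only [Finset.sum_sigma']
  apply Finset.sum_nbij' (fun ⟨⟨_i, j⟩, ⟨k, l⟩⟩ ↦ ⟨(k, l + j), (l, j)⟩)
    (fun ⟨⟨i, _j⟩, ⟨k, l⟩⟩ ↦ ⟨(i + k, l), (i, k)⟩)
    <;> simp <;> grind

protected theorem mul_assoc' (F G H : QPlane γ) : F * G * H = F * (G * H) := by
  ext m n
  simp only [mul_apply, Finset.sum_mul, Finset.mul_sum]
  have h1 : ∀ s ∈ antidiagonal m,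
      (∑ t ∈ antidiagonal n, ∑ s' ∈ antidiagonal s.1, ∑ t' ∈ antidiagonal t.1,
        v ^ (2 * γ * t.1 * s.2) * (v ^ (2 * γ * t'.1 * s'.2) * F (s'.1, t'.1) * G (s'.2, t'.2))
          * H (s.2, t.2))
      = ∑ s' ∈ antidiagonal s.1, ∑ t ∈ antidiagonal n, ∑ t' ∈ antidiagonal t.2,
        v ^ (2 * γ * (t.1 + t'.1) * s.2) * (v ^ (2 * γ * t.1 * s'.2) * F (s'.1, t.1)
          * G (s'.2, t'.1)) * H (s.2, t'.2) := by
    intro s _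
    rw [Finset.sum_comm]
    refine Finset.sum_congr rfl fun s' _ => ?_
    rw [← sum_antidiagonal_assoc (fun a b c => v ^ (2 * γ * (a + b) * s.2)
      * (v ^ (2 * γ * a * s'.2) * F (s'.1, a) * G (s'.2, b)) * H (s.2, c))]
    refine Finset.sum_congr rfl fun t _ => Finset.sum_congr rfl fun t' ht' => ?_
    rw [HasAntidiagonal.mem_antidiagonal.1 ht']
  rw [Finset.sum_congr rfl h1]
  rw [sum_antidiagonal_assoc (fun a b c => ∑ t ∈ antidiagonal n, ∑ t' ∈ antidiagonal t.2,
        v ^ (2 * γ * (t.1 + t'.1) * c) * (v ^ (2 * γ * t.1 * b) * F (a, t.1)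
          * G (b, t'.1)) * H (c, t'.2))]
  refine Finset.sum_congr rfl fun s _ => ?_
  rw [Finset.sum_comm]
  refine Finset.sum_congr rfl fun t _ => Finset.sum_congr rfl fun s' hs' =>
    Finset.sum_congr rfl fun t' _ => ?_
  rw [← HasAntidiagonal.mem_antidiagonal.1 hs']
  ring

instance : Ring (QPlane γ) where
  __ := (inferInstance : AddCommGroup (QPlane γ))
  mul_assoc := QPlane.mul_assoc'
  left_distrib F G H := by
    ext m n
    simp only [mul_apply, add_apply, mul_add, Finset.sum_add_distrib]
  right_distrib F G H := by
    ext m n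
    simp only [mul_apply, add_apply, mul_add, add_mul, Finset.sum_add_distrib]
  zero_mul F := by
    ext m n
    simp [mul_apply]
  mul_zero F := by
    ext m n
    simp [mul_apply]
  one_mul F := by
    ext m n
    rw [mul_apply, Finset.sum_eq_single_of_mem (0, m) (by simp),
      Finset.sum_eq_single_of_mem (0, n) (by simp)]
    · simp [one_apply]
    · rintro ⟨a, b⟩ h hne
      rw [HasAntidiagonal.mem_antidiagonal] at h
      have : a ≠ 0 := by rintro rfl; simp_all
      simp [one_apply, this]
    · rintro ⟨a, b⟩ h hne
      rw [HasAntidiagonal.mem_antidiagonal] at h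
      have : a ≠ 0 := by rintro rfl; simp_all
      simp [one_apply, this]
  mul_one F := by
    ext m n
    rw [mul_apply, Finset.sum_eq_single_of_mem (m, 0) (by simp),
      Finset.sum_eq_single_of_mem (n, 0) (by simp)]
    · simp [one_apply]
    · rintro ⟨a, b⟩ h hne
      rw [HasAntidiagonal.mem_antidiagonal] at h
      have : b ≠ 0 := by rintro rfl; simp_all
      simp [one_apply, this]
    · rintro ⟨a, b⟩ h hne
      rw [HasAntidiagonal.mem_antidiagonal] at h
      have : b ≠ 0 := by rintro rfl; simp_all
      simp [one_apply, this]

instance : Algebra K (QPlane γ) := Algebra.ofModule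
  (fun c F G => by
    ext m n
    simp only [mul_apply, smul_apply, Finset.mul_sum]
    exact Finset.sum_congr rfl fun _ _ => Finset.sum_congr rfl fun _ _ => by ring)
  (fun c F G => by
    ext m n
    simp only [mul_apply, smul_apply, Finset.mul_sum]
    exact Finset.sum_congr rfl fun _ _ => Finset.sum_congr rfl fun _ _ => by ring)

theorem mul_apply_congr {F F' G G' : QPlane γ} {m n : ℕ}
    (hF : ∀ a b, a ≤ m → b ≤ n → F (a, b) = F' (a, b))
    (hG : ∀ a b, a ≤ m → b ≤ n → G (a, b) = G' (a, b)) :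
    (F * G) (m, n) = (F' * G') (m, n) := by
  rw [mul_apply, mul_apply]
  refine Finset.sum_congr rfl fun s hs => Finset.sum_congr rfl fun t ht => ?_
  rw [HasAntidiagonal.mem_antidiagonal] at hs ht
  rw [hF _ _ (by omega) (by omega), hG _ _ (by omega) (by omega)]

theorem pow_apply_eq_zero {Z : QPlane γ} (hZ : Z (0, 0) = 0) (j : ℕ) :
    ∀ m n, m + n < j → (Z ^ j) (m, n) = 0 := by
  induction j with
  | zero => intro m n h; omega
  | succ j ih =>
    intro m n h
    rw [pow_succ', mul_apply]
    refine Finset.sum_eq_zero fun s hs => Finset.sum_eq_zero fun t ht => ?_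
    rw [HasAntidiagonal.mem_antidiagonal] at hs ht
    by_cases h0 : s.1 = 0 ∧ t.1 = 0
    · rw [h0.1, h0.2, hZ]; ring
    · rw [ih s.2 t.2 (by omega), mul_zero]

/-- The partial sum `Σ_{i < N} f_i Z^i`. -/
def partialEval (Z : QPlane γ) (f : PowerSeries K) (N : ℕ) : QPlane γ :=
  ∑ i ∈ range N, PowerSeries.coeff i f • Z ^ i

theorem partialEval_apply_of_lt {Z : QPlane γ} (hZ : Z (0, 0) = 0) (f : PowerSeries K)
    {m n N : ℕ} (h : m + n < N) :
    partialEval Z f N (m, n) = partialEval Z f (m + n + 1) (m, n) := by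
  rw [partialEval, partialEval, sum_apply, sum_apply]
  refine (Finset.sum_subset (by simpa using h) fun i _ hi => ?_).symm
  rw [smul_apply, pow_apply_eq_zero hZ _ _ _ (by simp at hi; omega), mul_zero]

/-- Evaluation of a power series in one variable at `Z`; meaningful when `Z` has zero constant
term. -/
def seriesEval (Z : QPlane γ) (f : PowerSeries K) : QPlane γ :=
  fun p => partialEval Z f (p.1 + p.2 + 1) p

theorem seriesEval_apply {Z : QPlane γ} (hZ : Z (0, 0) = 0) (f : PowerSeries K)
    {m n N : ℕ} (h : m + n < N) : seriesEval Z f (m, n) = partialEval Z f N (m, n) :=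
  (partialEval_apply_of_lt hZ f h).symm

theorem seriesEval_add (Z : QPlane γ) (f g : PowerSeries K) :
    seriesEval Z (f + g) = seriesEval Z f + seriesEval Z g := by
  ext m n
  simp [seriesEval, partialEval, add_smul, Finset.sum_add_distrib]

theorem partialEval_eq_aeval (Z : QPlane γ) (f : PowerSeries K) (N : ℕ) :
    partialEval Z f N = Polynomial.aeval Z (PowerSeries.trunc N f) := by
  rw [Polynomial.aeval_def, PowerSeries.eval₂_trunc_eq_sum_range, partialEval]
  simp [Algebra.smul_def]

theorem aeval_apply_eq_zero {Z : QPlane γ} (hZ : Z (0, 0) = 0) (P : Polynomial K) {m n : ℕ}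
    (h : ∀ i ≤ m + n, P.coeff i = 0) : Polynomial.aeval Z P (m, n) = 0 := by
  rw [Polynomial.aeval_eq_sum_range, sum_apply]
  refine Finset.sum_eq_zero fun i _ => ?_
  rw [smul_apply]
  by_cases hi : i ≤ m + n
  · rw [h i hi, zero_mul]
  · rw [pow_apply_eq_zero hZ _ _ _ (by omega), mul_zero]

theorem seriesEval_mul {Z : QPlane γ} (hZ : Z (0, 0) = 0) (f g : PowerSeries K) :
    seriesEval Z (f * g) = seriesEval Z f * seriesEval Z g := by
  ext m n
  have h : (seriesEval Z f * seriesEval Z g) (m, n)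
      = (partialEval Z f (m + n + 1) * partialEval Z g (m + n + 1)) (m, n) :=
    mul_apply_congr (fun a b _ _ => seriesEval_apply hZ f (by omega))
      (fun a b _ _ => seriesEval_apply hZ g (by omega))
  rw [h, seriesEval_apply hZ _ (Nat.lt_succ_self _)]
  simp only [partialEval_eq_aeval]
  rw [← map_mul]
  have key := aeval_apply_eq_zero hZ (m := m) (n := n)
    (PowerSeries.trunc (m + n + 1) (f * g)
      - PowerSeries.trunc (m + n + 1) f * PowerSeries.trunc (m + n + 1) g) fun i hi => by
    rw [Polynomial.coeff_sub, PowerSeries.coeff_trunc, if_pos (by omega),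
      PowerSeries.coeff_mul_eq_coeff_trunc_mul_trunc f g (show i < m + n + 1 by omega),
      ← Polynomial.coe_mul, Polynomial.coeff_coe, sub_self]
  rw [map_sub] at key
  exact sub_eq_zero.1 key

theorem seriesEval_one (Z : QPlane γ) : seriesEval Z 1 = 1 := by
  ext m n
  simp [seriesEval, partialEval, PowerSeries.coeff_one, ite_smul]

theorem seriesEval_X {Z : QPlane γ} (hZ : Z (0, 0) = 0) : seriesEval Z PowerSeries.X = Z := by
  ext m n
  rw [seriesEval_apply hZ _ (show m + n < m + n + 2 by omega), partialEval_eq_aeval,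
    PowerSeries.trunc_X, Polynomial.aeval_X]

theorem seriesEval_C (Z : QPlane γ) (c : K) : seriesEval Z (PowerSeries.C c) = c • 1 := by
  ext m n
  simp [seriesEval, partialEval, PowerSeries.coeff_C, ite_smul]

theorem seriesEval_one_add {Z : QPlane γ} (hZ : Z (0, 0) = 0) (c : K) :
    seriesEval Z (1 + PowerSeries.C c * PowerSeries.X) = 1 + c • Z := by
  rw [seriesEval_add, seriesEval_one, seriesEval_mul hZ, seriesEval_X hZ, seriesEval_C,
    smul_mul_assoc, one_mul]

theorem seriesEval_pow {Z : QPlane γ} (hZ : Z (0, 0) = 0) (f : PowerSeries K) (k : ℕ) :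
    seriesEval Z (f ^ k) = seriesEval Z f ^ k := by
  induction k with
  | zero => rw [pow_zero, pow_zero, seriesEval_one]
  | succ k ih => rw [pow_succ, pow_succ, seriesEval_mul hZ, ih]

theorem mul_pow_of_mul_eq {M Z : QPlane γ} {c : K} (h : M * Z = c • (Z * M)) (i : ℕ) :
    M * Z ^ i = c ^ i • (Z ^ i * M) := by
  induction i with
  | zero => simp
  | succ i ih =>
    rw [pow_succ, ← mul_assoc, ih, smul_mul_assoc, mul_assoc, h, mul_smul_comm, smul_smul,
      pow_succ, mul_assoc]

theorem mul_seriesEval {M Z : QPlane γ} (hZ : Z (0, 0) = 0) {c : K} (h : M * Z = c • (Z * M))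
    (f : PowerSeries K) :
    M * seriesEval Z f = seriesEval Z (PowerSeries.rescale c f) * M := by
  ext m n
  rw [mul_apply_congr (F' := M) (G' := partialEval Z f (m + n + 1)) (fun _ _ _ _ => rfl)
      (fun a b _ _ => seriesEval_apply hZ f (by omega)),
    mul_apply_congr (F := seriesEval Z _) (G' := M)
      (F' := partialEval Z (PowerSeries.rescale c f) (m + n + 1))
      (fun a b _ _ => seriesEval_apply hZ _ (by omega)) (fun _ _ _ _ => rfl)]
  refine congrFun (?_ : (_ : QPlane γ) = _) _
  rw [partialEval, partialEval, Finset.mul_sum, Finset.sum_mul]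
  refine Finset.sum_congr rfl fun i _ => ?_
  rw [mul_smul_comm, mul_pow_of_mul_eq h, smul_smul, PowerSeries.coeff_rescale, smul_mul_assoc,
    mul_comm]

/-- The automorphism of the quantum plane scaling `Y₁` by `c`. -/
def scale (c : K) : QPlane γ →ₐ[K] QPlane γ :=
  AlgHom.ofLinearMap
    { toFun := fun F p => c ^ p.1 * F p
      map_add' := fun F G => by ext m n; exact mul_add _ _ _
      map_smul' := fun a F => by ext m n; exact mul_left_comm _ _ _ }
    (by
      ext m n
      change c ^ m * (1 : QPlane γ) (m, n) = _
      rw [one_apply]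
      split_ifs with h <;> simp_all)
    (fun F G => by
      ext m n
      change c ^ m * (F * G) (m, n) = _
      rw [mul_apply, mul_apply, Finset.mul_sum]
      refine Finset.sum_congr rfl fun s hs => ?_
      rw [Finset.mul_sum]
      refine Finset.sum_congr rfl fun t ht => ?_
      change _ = _ * (c ^ s.1 * F (s.1, t.1)) * (c ^ s.2 * G (s.2, t.2))
      rw [← HasAntidiagonal.mem_antidiagonal.1 hs]
      ring)

theorem scale_apply (c : K) (F : QPlane γ) (m n : ℕ) : scale c F (m, n) = c ^ m * F (m, n) := rfl

theorem scale_seriesEval {Z : QPlane γ} {c d : K} (h : scale c Z = d • Z)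
    (f : PowerSeries K) :
    scale c (seriesEval Z f) = seriesEval Z (PowerSeries.rescale d f) := by
  ext m n
  rw [scale_apply]
  change c ^ m * partialEval Z f (m + n + 1) (m, n) = partialEval Z _ (m + n + 1) (m, n)
  rw [← scale_apply, partialEval, partialEval, map_sum]
  refine congrFun (?_ : (_ : QPlane γ) = _) _
  refine Finset.sum_congr rfl fun i _ => ?_
  rw [map_smul, map_pow, h, smul_pow, smul_smul, PowerSeries.coeff_rescale, mul_comm]

/-- The specialization `Y₁ = 0`. -/
def atZero : QPlane γ →+* PowerSeries K where
  toFun := fun (F : QPlane γ) => PowerSeries.mk fun n => F (0, n)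
  map_one' := by
    ext n
    simp [one_apply, PowerSeries.coeff_one]
  map_zero' := by ext n; simp
  map_add' F G := by ext n; simp
  map_mul' F G := by
    ext n
    simp [PowerSeries.coeff_mul, mul_apply]

theorem coeff_atZero (F : QPlane γ) (n : ℕ) : PowerSeries.coeff n (atZero F) = F (0, n) := by
  change PowerSeries.coeff n (PowerSeries.mk fun n => F (0, n)) = F (0, n)
  rw [PowerSeries.coeff_mk]

theorem atZero_smul (c : K) (F : QPlane γ) : atZero (c • F) = c • atZero F := by
  ext n
  simp [coeff_atZero]

theorem atZero_seriesEval {Z : QPlane γ} (h : atZero Z = 0) {f : PowerSeries K}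
    (hf : PowerSeries.constantCoeff f = 1) : atZero (seriesEval Z f) = 1 := by
  ext n
  rw [coeff_atZero]
  change partialEval Z f (0 + n + 1) (0, n) = _
  rw [← coeff_atZero (partialEval Z f (0 + n + 1)), partialEval, map_sum, Finset.sum_range_succ', Finset.sum_eq_zero]
  · simp [hf]
  · intro i _
    rw [atZero_smul, map_pow, h, zero_pow (by omega), smul_zero]

theorem eq_of_scale_eq {c : K} (hc : ∀ m : ℕ, 0 < m → c ^ m ≠ 1) {U F G : QPlane γ}
    (hU : atZero U = 1) (hF : scale c F = U * F) (hG : scale c G = U * G)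
    (h0 : atZero F = atZero G) : F = G := by
  rw [← sub_eq_zero]
  have hD : scale c (F - G) = U * (F - G) := by rw [map_sub, hF, hG, mul_sub]
  have hD0 : atZero (F - G) = 0 := by rw [map_sub, h0, sub_self]
  generalize F - G = D at hD hD0
  suffices h : ∀ m n, D (m, n) = 0 from ext h
  intro m
  induction m using Nat.strong_induction_on with
  | _ m ih =>
    intro n
    rcases Nat.eq_zero_or_pos m with rfl | hm
    · rw [← coeff_atZero D n, hD0]; simp
    · have hU' : ∀ b, U (0, b) = if b = 0 then 1 else 0 := fun b => by
        rw [← coeff_atZero U b, hU, PowerSeries.coeff_one]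
      have key : (U * D) (m, n) = D (m, n) := by
        rw [mul_apply, Finset.sum_eq_single_of_mem (0, m) (by simp),
          Finset.sum_eq_single_of_mem (0, n) (by simp)]
        · simp [hU']
        · rintro ⟨a, b⟩ h hne
          rw [HasAntidiagonal.mem_antidiagonal] at h
          have : a ≠ 0 := by rintro rfl; simp_all
          simp [hU', this]
        · rintro ⟨a, b⟩ h hne
          rw [HasAntidiagonal.mem_antidiagonal] at h
          have : a ≠ 0 := by rintro rfl; simp_all
          refine Finset.sum_eq_zero fun t _ => ?_
          rw [ih b (by simp at h; omega)]
          simp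
      rw [← hD, scale_apply] at key
      have : (c ^ m - 1) * D (m, n) = 0 := by rw [sub_mul, key, one_mul, sub_self]
      exact (mul_eq_zero.1 this).resolve_left (sub_ne_zero.2 (hc m hm))

theorem qpow_eq_pow (Z : QPlane γ) (k : ℕ) : qpow γ Z k = Z ^ k := by
  induction k with
  | zero => rw [pow_zero]; rfl
  | succ k ih =>
    rw [pow_succ']
    change qmul γ Z (qpow γ Z k) = _
    rw [ih]
    rfl

theorem qarg_eq_seriesEval (w : K) (Z : QPlane γ) :
    qarg γ w Z = seriesEval Z (qlogSeries w) := by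
  refine ext (γ := γ) fun m n => ?_
  change _ = partialEval Z _ (m + n + 1) (m, n)
  rw [partialEval, sum_apply, Finset.sum_range_succ']
  simp only [qarg, qpow_eq_pow, smul_apply, qlogSeries, PowerSeries.coeff_mk]
  rw [← Finset.Ico_add_one_right_eq_Icc, Finset.sum_Ico_eq_sum_range]
  simp [add_comm]

theorem qPsi_eq_seriesEval (w : K) {Z : QPlane γ} (hZ : Z (0, 0) = 0) :
    qPsi γ w Z = seriesEval Z (qdilogSeries w) := by
  refine ext (γ := γ) fun m n => ?_
  have h : ∀ k, qpow γ (qarg γ w Z) k = seriesEval Z (qlogSeries w ^ k) := fun k => by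
    rw [qarg_eq_seriesEval, qpow_eq_pow, seriesEval_pow hZ]
  change _ = partialEval Z _ (m + n + 1) (m, n)
  rw [partialEval, sum_apply]
  change ∑ k ∈ range (m + n + 1), (Nat.factorial k : K)⁻¹ * qpow γ (qarg γ w Z) k (m, n) = _
  simp only [h]
  have h' : ∀ k, seriesEval Z (qlogSeries w ^ k) (m, n)
      = ∑ i ∈ range (m + n + 1), PowerSeries.coeff i (qlogSeries w ^ k) * (Z ^ i) (m, n) :=
    fun k => by
      change partialEval Z _ (m + n + 1) (m, n) = _
      rw [partialEval, sum_apply]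
      rfl
  simp only [h', Finset.mul_sum]
  rw [Finset.sum_comm]
  refine Finset.sum_congr rfl fun i hi => ?_
  rw [smul_apply, coeff_qdilogSeries w (Finset.mem_range.1 hi), Finset.sum_mul]
  exact Finset.sum_congr rfl fun k _ => (mul_assoc _ _ _).symm

/-- The quantum dilogarithm as an element of the ring `QPlane γ`. -/
def dilog (w : K) (Z : QPlane γ) : QPlane γ := seriesEval Z (qdilogSeries w)

/-- The polynomial `∏_{i < k} (1 + w^{2i+1} Z)` relating `Ψ_w(w^{2k} Z)` to `Ψ_w(Z)`. -/
def dilogRatio (w : K) (Z : QPlane γ) : ℕ → QPlane γ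
  | 0 => 1
  | k + 1 => (1 + w ^ (2 * k + 1) • Z) * dilogRatio w Z k

theorem seriesEval_rescale_qdilogSeries {w : K} (hw : ∀ j : ℕ, 0 < j → w ^ j - w⁻¹ ^ j ≠ 0)
    {Z : QPlane γ} (hZ : Z (0, 0) = 0) (k : ℕ) :
    seriesEval Z (PowerSeries.rescale (w ^ (2 * k)) (qdilogSeries w))
      = dilogRatio w Z k * dilog w Z := by
  induction k with
  | zero => simp [dilog, dilogRatio]
  | succ k ih =>
    rw [show w ^ (2 * (k + 1)) = w ^ (2 * k) * w ^ 2 by ring, rescale_mul_sq_qdilogSeries hw,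
      seriesEval_mul hZ, seriesEval_one_add hZ, ih, dilogRatio, pow_succ w (2 * k), mul_assoc]

theorem dilogRatio_commute (w : K) {Z : QPlane γ} (hZ : Z (0, 0) = 0) (k : ℕ) :
    Commute (dilogRatio w Z k) (dilog w Z) := by
  have hc : Commute Z (dilog w Z) := by
    have := congrArg (seriesEval Z) (mul_comm PowerSeries.X (qdilogSeries w))
    rwa [seriesEval_mul hZ, seriesEval_mul hZ, seriesEval_X hZ] at this
  induction k with
  | zero => exact Commute.one_left _
  | succ k ih => exact ((Commute.one_left _).add_left (hc.smul_left _)).mul_left ih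

theorem mul_dilog {w : K} (hw : ∀ j : ℕ, 0 < j → w ^ j - w⁻¹ ^ j ≠ 0)
    {M Z : QPlane γ} (hZ : Z (0, 0) = 0) (k : ℕ) (h : M * Z = w ^ (2 * k) • (Z * M)) :
    M * dilog w Z = dilog w Z * (dilogRatio w Z k * M) := by
  rw [dilog, mul_seriesEval hZ h, seriesEval_rescale_qdilogSeries hw hZ,
    (dilogRatio_commute w hZ k).eq, mul_assoc, dilog]

theorem dilog_mul {w : K} (hw : ∀ j : ℕ, 0 < j → w ^ j - w⁻¹ ^ j ≠ 0) (hw0 : w ≠ 0)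
    {M Z : QPlane γ} (hZ : Z (0, 0) = 0) (k : ℕ) (h : Z * M = w ^ (2 * k) • (M * Z)) :
    dilog w Z * M = M * dilogRatio w Z k * dilog w Z := by
  have hk : w ^ (2 * k) ≠ 0 := pow_ne_zero _ hw0
  have h' : M * Z = (w ^ (2 * k))⁻¹ • (Z * M) := by rw [h, inv_smul_smul₀ hk]
  rw [mul_assoc, ← seriesEval_rescale_qdilogSeries hw hZ, mul_seriesEval hZ h',
    ← RingHom.comp_apply, ← PowerSeries.rescale_mul, mul_inv_cancel₀ hk, PowerSeries.rescale_one,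
    RingHom.id_apply, dilog]

theorem scale_dilog {w c : K} (hw : ∀ j : ℕ, 0 < j → w ^ j - w⁻¹ ^ j ≠ 0)
    {Z : QPlane γ} (hZ : Z (0, 0) = 0) (k : ℕ) (h : scale c Z = w ^ (2 * k) • Z) :
    scale c (dilog w Z) = dilog w Z * dilogRatio w Z k := by
  rw [dilog, scale_seriesEval h, seriesEval_rescale_qdilogSeries hw hZ,
    (dilogRatio_commute w hZ k).eq, dilog]

theorem atZero_dilog (w : K) {Z : QPlane γ} (h : atZero Z = 0) : atZero (dilog w Z) = 1 :=
  atZero_seriesEval h (constantCoeff_qdilogSeries w)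

/-- The monomial `Y₁^m Y₂^n`. -/
def mono (m n : ℕ) : QPlane γ := fun p => if p = (m, n) then 1 else 0

theorem mono_apply (m n : ℕ) (p : ℕ × ℕ) :
    (mono m n : QPlane γ) p = if p = (m, n) then 1 else 0 := rfl

theorem one_eq_mono : (1 : QPlane γ) = mono 0 0 := rfl

theorem mono_mul_mono (m n m' n' : ℕ) :
    (mono m n * mono m' n' : QPlane γ) = v ^ (2 * γ * n * m') • mono (m + m') (n + n') := by
  ext a b
  rw [mul_apply, smul_apply, mono_apply]
  by_cases h : (a, b) = (m + m', n + n')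
  · obtain ⟨rfl, rfl⟩ := Prod.mk.inj h
    rw [Finset.sum_eq_single_of_mem (m, m') (by simp),
      Finset.sum_eq_single_of_mem (n, n') (by simp)]
    · simp [mono_apply]
    · rintro ⟨c, d⟩ hcd hne
      have : ¬ (c = n ∧ d = n') := fun h => hne (by rw [h.1, h.2])
      simp only [mono_apply, Prod.mk.injEq, true_and]
      split_ifs <;> simp_all
    · rintro ⟨c, d⟩ hcd hne
      refine Finset.sum_eq_zero fun t _ => ?_
      simp only [mono_apply, Prod.mk.injEq]
      split_ifs <;> simp_all
  · rw [if_neg h, mul_zero]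
    refine Finset.sum_eq_zero fun s hs => Finset.sum_eq_zero fun t ht => ?_
    rw [HasAntidiagonal.mem_antidiagonal] at hs ht
    simp only [mono_apply, Prod.mk.injEq] at h ⊢
    split_ifs <;> simp_all

theorem scale_mono (c : K) (m n : ℕ) : scale c (mono m n : QPlane γ) = c ^ m • mono m n := by
  ext a b
  rw [scale_apply, smul_apply, mono_apply]
  split_ifs with h
  · rw [(Prod.mk.inj h).1]
  · simp

theorem atZero_mono {m : ℕ} (hm : m ≠ 0) (n : ℕ) : atZero (mono m n : QPlane γ) = 0 := by
  ext b
  rw [coeff_atZero, mono_apply, if_neg (by simp [hm.symm])]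
  simp

theorem qy_zero_eq_smul_mono (m n : ℕ) :
    (qy γ 0 m n : QPlane γ) = v ^ (γ * m * n) • (mono m n : QPlane γ) := by
  refine ext (γ := γ) fun a b => ?_
  rw [smul_apply, mono_apply, qy]
  split_ifs
  · rw [zero_add, mul_one]
    exact_mod_cast zpow_natCast v (γ * m * n)
  · rw [mul_zero]

theorem smul_mono_apply_zero (c : K) {m n : ℕ} (h : (m, n) ≠ (0, 0)) :
    (c • (mono m n : QPlane γ)) (0, 0) = 0 := by
  rw [smul_apply, mono_apply, if_neg h.symm, mul_zero]

theorem v_pow_ne_one {m : ℕ} (hm : 0 < m) : v ^ m ≠ 1 := by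
  intro h
  rw [v, ← RatFunc.algebraMap_X, ← map_pow,
    ← map_one (algebraMap (Polynomial ℚ) (RatFunc ℚ))] at h
  have h' := congrArg Polynomial.natDegree (RatFunc.algebraMap_injective ℚ h)
  rw [Polynomial.natDegree_X_pow, Polynomial.natDegree_one] at h'
  omega

theorem v_ne_zero : v ≠ 0 := RatFunc.X_ne_zero

theorem v_pow_sub_inv_ne_zero {r : ℕ} (hr : 0 < r) (j : ℕ) (hj : 0 < j) :
    (v ^ r) ^ j - (v ^ r)⁻¹ ^ j ≠ 0 := by
  intro h
  have h0 : ((v ^ r) ^ j) ≠ 0 := pow_ne_zero _ (pow_ne_zero _ v_ne_zero)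
  refine v_pow_ne_one (m := r * j + r * j) (by positivity) ?_
  rw [pow_add, pow_mul]
  nth_rewrite 2 [sub_eq_zero.1 h]
  rw [inv_pow, mul_inv_cancel₀ h0]

/-- The normalized monomial `y^{(m,n)}` of `A₃`. -/
def ymono (m n : ℕ) : QPlane 3 := v ^ (3 * m * n) • mono m n

theorem ymono_def (m n : ℕ) : ymono m n = v ^ (3 * m * n) • mono m n := rfl

theorem ymono_apply_zero {m n : ℕ} (h : (m, n) ≠ (0, 0)) : ymono m n (0, 0) = 0 :=
  smul_mono_apply_zero _ h

theorem mono_mul_dilog_ymono {r k m n m' n' : ℕ} (hr : 0 < r) (h0 : (m', n') ≠ (0, 0))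
    (h : 3 * (n * m') = r * k + 3 * (n' * m)) :
    mono m n * dilog (v ^ r) (ymono m' n')
      = dilog (v ^ r) (ymono m' n') * (dilogRatio (v ^ r) (ymono m' n') k * mono m n) := by
  refine mul_dilog (v_pow_sub_inv_ne_zero hr) (ymono_apply_zero h0) k ?_
  rw [ymono_def, mul_smul_comm, smul_mul_assoc, mono_mul_mono, mono_mul_mono, smul_smul, smul_smul,
    smul_smul, add_comm m, add_comm n]
  congr 1
  rw [show 2 * 3 * n * m' = 2 * (3 * (n * m')) by ring, h]
  ring

theorem scale_dilog_ymono {r k m n : ℕ} (hr : 0 < r) (h0 : (m, n) ≠ (0, 0))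
    (h : 3 * m = r * k) :
    scale (v ^ 6) (dilog (v ^ r) (ymono m n))
      = dilog (v ^ r) (ymono m n) * dilogRatio (v ^ r) (ymono m n) k := by
  refine scale_dilog (v_pow_sub_inv_ne_zero hr) (ymono_apply_zero h0) k ?_
  rw [ymono_def, map_smul, scale_mono, smul_comm, ← pow_mul, ← pow_mul,
    show 6 * m = 2 * (3 * m) by ring, h]
  congr 2
  ring

theorem atZero_dilog_ymono (r : ℕ) {m : ℕ} (n : ℕ) (hm : m ≠ 0) :
    atZero (dilog (v ^ r) (ymono m n)) = 1 :=
  atZero_dilog _ (by rw [ymono_def, atZero_smul, atZero_mono hm, smul_zero])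

theorem qPsi_qy (r : ℕ) {m n : ℕ} (h0 : (m, n) ≠ (0, 0)) :
    qPsi 3 (v ^ r) (qy 3 0 m n) = dilog (v ^ r) (ymono m n) := by
  have h : (qy 3 0 m n : QPlane 3) = ymono m n := qy_zero_eq_smul_mono m n
  exact (congrArg (qPsi 3 (v ^ r)) h).trans (qPsi_eq_seriesEval _ (ymono_apply_zero h0))

/-- The multiplier `1 + v³ Y₁(1 + vY₂)(1 + v³Y₂)(1 + v⁵Y₂)` of both sides of the relation
under the scaling of `Y₁` by `v⁶`. -/
def scaleFactor : QPlane 3 :=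
  1 + v ^ 3 • mono 1 0 + (v ^ 4 + v ^ 6 + v ^ 8) • mono 1 1
    + (v ^ 7 + v ^ 9 + v ^ 11) • mono 1 2 + v ^ 12 • mono 1 3

/-- The factor left of `Ψ_v(y^{(1,1)})` after moving `scaleFactor` past `Ψ_{v³}(y^{(1,0)})`. -/
def factor₁₁ : QPlane 3 :=
  1 + (v ^ 4 + v ^ 6 + v ^ 8) • mono 1 1 + (v ^ 7 + v ^ 9 + v ^ 11) • mono 1 2
    + (v ^ 16 + v ^ 18 + v ^ 20) • mono 2 2 + v ^ 12 • mono 1 3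
    + (v ^ 21 + v ^ 27) • mono 2 3 + v ^ 36 • mono 3 3

/-- The factor left of `Ψ_{v³}(y^{(2,3)})`. -/
def factor₂₃ : QPlane 3 :=
  1 + (v ^ 7 + v ^ 9 + v ^ 11) • mono 1 2 + v ^ 12 • mono 1 3
    + (v ^ 21 + v ^ 27) • mono 2 3 + (v ^ 28 + v ^ 30 + v ^ 32) • mono 2 4
    + (v ^ 52 + v ^ 54 + v ^ 56) • mono 3 5 + v ^ 84 • mono 4 6

/-- The factor left of `Ψ_v(y^{(1,2)})`. -/
def factor₁₂ : QPlane 3 :=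
  1 + (v ^ 7 + v ^ 9 + v ^ 11) • mono 1 2 + v ^ 12 • mono 1 3
    + (v ^ 28 + v ^ 30 + v ^ 32) • mono 2 4 + v ^ 63 • mono 3 6

/-- The factor left of `Ψ_{v³}(y^{(1,3)})`. -/
def factor₁₃ : QPlane 3 := 1 + v ^ 12 • mono 1 3

theorem scaleFactor_mul_dilog :
    scaleFactor * dilog (v ^ 3) (ymono 1 0)
      = dilog (v ^ 3) (ymono 1 0) * (dilogRatio (v ^ 3) (ymono 1 0) 1 * factor₁₁) := by
  have key : dilogRatio (v ^ 3) (ymono 1 0) 1 * factor₁₁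
      = 1 + v ^ 3 • (dilogRatio (v ^ 3) (ymono 1 0) 0 * mono 1 0)
        + (v ^ 4 + v ^ 6 + v ^ 8) • (dilogRatio (v ^ 3) (ymono 1 0) 1 * mono 1 1)
        + (v ^ 7 + v ^ 9 + v ^ 11) • (dilogRatio (v ^ 3) (ymono 1 0) 2 * mono 1 2)
        + v ^ 12 • (dilogRatio (v ^ 3) (ymono 1 0) 3 * mono 1 3) := by
    simp only [factor₁₁, dilogRatio, ymono_def, one_eq_mono, add_mul, mul_add, smul_mul_assoc,
      mul_smul_comm, mono_mul_mono, Nat.reduceAdd]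
    ext a b
    simp only [add_apply, smul_apply]
    ring
  have h₀ := mono_mul_dilog_ymono (r := 3) (k := 0) (m := 1) (n := 0) (m' := 1) (n' := 0)
    (by simp) (by simp) rfl
  have h₁ := mono_mul_dilog_ymono (r := 3) (k := 1) (m := 1) (n := 1) (m' := 1) (n' := 0)
    (by simp) (by simp) rfl
  have h₂ := mono_mul_dilog_ymono (r := 3) (k := 2) (m := 1) (n := 2) (m' := 1) (n' := 0)
    (by simp) (by simp) rfl
  have h₃ := mono_mul_dilog_ymono (r := 3) (k := 3) (m := 1) (n := 3) (m' := 1) (n' := 0)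
    (by simp) (by simp) rfl
  rw [key]
  simp only [scaleFactor, add_mul, one_mul, smul_mul_assoc, h₀, h₁, h₂, h₃, mul_add, mul_one,
    mul_smul_comm]

theorem factor₁₁_mul_dilog :
    factor₁₁ * dilog (v ^ 1) (ymono 1 1)
      = dilog (v ^ 1) (ymono 1 1) * (dilogRatio (v ^ 1) (ymono 1 1) 3 * factor₂₃) := by
  have key : dilogRatio (v ^ 1) (ymono 1 1) 3 * factor₂₃
      = 1 + (v ^ 4 + v ^ 6 + v ^ 8) • (dilogRatio (v ^ 1) (ymono 1 1) 0 * mono 1 1)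
        + (v ^ 7 + v ^ 9 + v ^ 11) • (dilogRatio (v ^ 1) (ymono 1 1) 3 * mono 1 2)
        + (v ^ 16 + v ^ 18 + v ^ 20) • (dilogRatio (v ^ 1) (ymono 1 1) 0 * mono 2 2)
        + v ^ 12 • (dilogRatio (v ^ 1) (ymono 1 1) 6 * mono 1 3)
        + (v ^ 21 + v ^ 27) • (dilogRatio (v ^ 1) (ymono 1 1) 3 * mono 2 3)
        + v ^ 36 • (dilogRatio (v ^ 1) (ymono 1 1) 0 * mono 3 3) := by
    simp only [factor₂₃, dilogRatio, ymono_def, one_eq_mono, add_mul, mul_add, smul_mul_assoc,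
      mul_smul_comm, mono_mul_mono, Nat.reduceAdd]
    ext a b
    simp only [add_apply, smul_apply]
    ring
  have h₀ := mono_mul_dilog_ymono (r := 1) (k := 0) (m := 1) (n := 1) (m' := 1) (n' := 1)
    (by simp) (by simp) rfl
  have h₁ := mono_mul_dilog_ymono (r := 1) (k := 3) (m := 1) (n := 2) (m' := 1) (n' := 1)
    (by simp) (by simp) rfl
  have h₂ := mono_mul_dilog_ymono (r := 1) (k := 0) (m := 2) (n := 2) (m' := 1) (n' := 1)
    (by simp) (by simp) rfl
  have h₃ := mono_mul_dilog_ymono (r := 1) (k := 6) (m := 1) (n := 3) (m' := 1) (n' := 1)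
    (by simp) (by simp) rfl
  have h₄ := mono_mul_dilog_ymono (r := 1) (k := 3) (m := 2) (n := 3) (m' := 1) (n' := 1)
    (by simp) (by simp) rfl
  have h₅ := mono_mul_dilog_ymono (r := 1) (k := 0) (m := 3) (n := 3) (m' := 1) (n' := 1)
    (by simp) (by simp) rfl
  rw [key]
  simp only [factor₁₁, add_mul, one_mul, smul_mul_assoc, h₀, h₁, h₂, h₃, h₄, h₅,
    mul_add, mul_one, mul_smul_comm]

theorem factor₂₃_mul_dilog :
    factor₂₃ * dilog (v ^ 3) (ymono 2 3)
      = dilog (v ^ 3) (ymono 2 3) * (dilogRatio (v ^ 3) (ymono 2 3) 2 * factor₁₂) := by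
  have key : dilogRatio (v ^ 3) (ymono 2 3) 2 * factor₁₂
      = 1 + (v ^ 7 + v ^ 9 + v ^ 11) • (dilogRatio (v ^ 3) (ymono 2 3) 1 * mono 1 2)
        + v ^ 12 • (dilogRatio (v ^ 3) (ymono 2 3) 3 * mono 1 3)
        + (v ^ 21 + v ^ 27) • (dilogRatio (v ^ 3) (ymono 2 3) 0 * mono 2 3)
        + (v ^ 28 + v ^ 30 + v ^ 32) • (dilogRatio (v ^ 3) (ymono 2 3) 2 * mono 2 4)
        + (v ^ 52 + v ^ 54 + v ^ 56) • (dilogRatio (v ^ 3) (ymono 2 3) 1 * mono 3 5)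
        + v ^ 84 • (dilogRatio (v ^ 3) (ymono 2 3) 0 * mono 4 6) := by
    simp only [factor₁₂, dilogRatio, ymono_def, one_eq_mono, add_mul, mul_add, smul_mul_assoc,
      mul_smul_comm, mono_mul_mono, Nat.reduceAdd]
    ext a b
    simp only [add_apply, smul_apply]
    ring
  have h₀ := mono_mul_dilog_ymono (r := 3) (k := 1) (m := 1) (n := 2) (m' := 2) (n' := 3)
    (by simp) (by simp) rfl
  have h₁ := mono_mul_dilog_ymono (r := 3) (k := 3) (m := 1) (n := 3) (m' := 2) (n' := 3)
    (by simp) (by simp) rfl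
  have h₂ := mono_mul_dilog_ymono (r := 3) (k := 0) (m := 2) (n := 3) (m' := 2) (n' := 3)
    (by simp) (by simp) rfl
  have h₃ := mono_mul_dilog_ymono (r := 3) (k := 2) (m := 2) (n := 4) (m' := 2) (n' := 3)
    (by simp) (by simp) rfl
  have h₄ := mono_mul_dilog_ymono (r := 3) (k := 1) (m := 3) (n := 5) (m' := 2) (n' := 3)
    (by simp) (by simp) rfl
  have h₅ := mono_mul_dilog_ymono (r := 3) (k := 0) (m := 4) (n := 6) (m' := 2) (n' := 3)
    (by simp) (by simp) rfl
  rw [key]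
  simp only [factor₂₃, add_mul, one_mul, smul_mul_assoc, h₀, h₁, h₂, h₃, h₄, h₅,
    mul_add, mul_one, mul_smul_comm]

theorem factor₁₂_mul_dilog :
    factor₁₂ * dilog (v ^ 1) (ymono 1 2)
      = dilog (v ^ 1) (ymono 1 2) * (dilogRatio (v ^ 1) (ymono 1 2) 3 * factor₁₃) := by
  have key : dilogRatio (v ^ 1) (ymono 1 2) 3 * factor₁₃
      = 1 + (v ^ 7 + v ^ 9 + v ^ 11) • (dilogRatio (v ^ 1) (ymono 1 2) 0 * mono 1 2)
        + v ^ 12 • (dilogRatio (v ^ 1) (ymono 1 2) 3 * mono 1 3)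
        + (v ^ 28 + v ^ 30 + v ^ 32) • (dilogRatio (v ^ 1) (ymono 1 2) 0 * mono 2 4)
        + v ^ 63 • (dilogRatio (v ^ 1) (ymono 1 2) 0 * mono 3 6) := by
    simp only [factor₁₃, dilogRatio, ymono_def, one_eq_mono, add_mul, mul_add, smul_mul_assoc,
      mul_smul_comm, mono_mul_mono, Nat.reduceAdd]
    ext a b
    simp only [add_apply, smul_apply]
    ring
  have h₀ := mono_mul_dilog_ymono (r := 1) (k := 0) (m := 1) (n := 2) (m' := 1) (n' := 2)
    (by simp) (by simp) rfl
  have h₁ := mono_mul_dilog_ymono (r := 1) (k := 3) (m := 1) (n := 3) (m' := 1) (n' := 2)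
    (by simp) (by simp) rfl
  have h₂ := mono_mul_dilog_ymono (r := 1) (k := 0) (m := 2) (n := 4) (m' := 1) (n' := 2)
    (by simp) (by simp) rfl
  have h₃ := mono_mul_dilog_ymono (r := 1) (k := 0) (m := 3) (n := 6) (m' := 1) (n' := 2)
    (by simp) (by simp) rfl
  rw [key]
  simp only [factor₁₂, add_mul, one_mul, smul_mul_assoc, h₀, h₁, h₂, h₃,
    mul_add, mul_one, mul_smul_comm]

theorem factor₁₃_mul_dilog :
    factor₁₃ * dilog (v ^ 3) (ymono 1 3)
      = dilog (v ^ 3) (ymono 1 3) * dilogRatio (v ^ 3) (ymono 1 3) 1 := by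
  have key : dilogRatio (v ^ 3) (ymono 1 3) 1
      = 1 + v ^ 12 • (dilogRatio (v ^ 3) (ymono 1 3) 0 * mono 1 3) := by
    simp only [dilogRatio, ymono_def, one_eq_mono, add_mul, smul_mul_assoc,
      mono_mul_mono, Nat.reduceAdd]
    ext a b
    simp only [add_apply, smul_apply]
    ring
  have h₀ := mono_mul_dilog_ymono (r := 3) (k := 0) (m := 1) (n := 3) (m' := 1) (n' := 3)
    (by simp) (by simp) rfl
  rw [key]
  simp only [factor₁₃, add_mul, one_mul, smul_mul_assoc, h₀,
    mul_add, mul_one, mul_smul_comm]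

theorem scale_dilog_mul_dilog :
    scale (v ^ 6) (dilog (v ^ 1) (ymono 0 1) * dilog (v ^ 3) (ymono 1 0))
      = scaleFactor * (dilog (v ^ 1) (ymono 0 1) * dilog (v ^ 3) (ymono 1 0)) := by
  have h : dilog (v ^ 1) (ymono 0 1) * mono 1 0
      = mono 1 0 * dilogRatio (v ^ 1) (ymono 0 1) 3 * dilog (v ^ 1) (ymono 0 1) := by
    refine dilog_mul (v_pow_sub_inv_ne_zero one_pos) (pow_ne_zero _ v_ne_zero)
      (ymono_apply_zero (by simp)) 3 ?_
    simp only [ymono_def, smul_mul_assoc, mul_smul_comm, mono_mul_mono, Nat.reduceAdd]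
    ext a b
    simp only [smul_apply]
    ring
  have hr : dilogRatio (v ^ 3) (ymono 1 0) 1 = 1 + v ^ 3 • mono 1 0 := by
    simp [dilogRatio, ymono_def]
  have hU : scaleFactor = 1 + v ^ 3 • (mono 1 0 * dilogRatio (v ^ 1) (ymono 0 1) 3) := by
    simp only [scaleFactor, dilogRatio, ymono_def, one_eq_mono, add_mul, mul_add, smul_mul_assoc,
      mul_smul_comm, mono_mul_mono, Nat.reduceAdd]
    ext a b
    simp only [add_apply, smul_apply]
    ring
  rw [map_mul, scale_dilog_ymono (k := 0) one_pos (by simp) rfl,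
    scale_dilog_ymono (k := 1) three_pos (by simp) rfl, ← (dilogRatio_commute _
      (ymono_apply_zero (by simp)) 1).eq, hr, hU, dilogRatio, mul_one, ← mul_assoc, ← mul_assoc,
    mul_add, mul_smul_comm, h, add_mul, smul_mul_assoc, mul_one, add_mul, add_mul, one_mul, smul_mul_assoc,
    smul_mul_assoc]

theorem scale_ordered_dilog_prod :
    scale (v ^ 6) (dilog (v ^ 3) (ymono 1 0) * (dilog (v ^ 1) (ymono 1 1)
        * (dilog (v ^ 3) (ymono 2 3) * (dilog (v ^ 1) (ymono 1 2)
          * (dilog (v ^ 3) (ymono 1 3) * dilog (v ^ 1) (ymono 0 1))))))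
      = scaleFactor * (dilog (v ^ 3) (ymono 1 0) * (dilog (v ^ 1) (ymono 1 1)
        * (dilog (v ^ 3) (ymono 2 3) * (dilog (v ^ 1) (ymono 1 2)
          * (dilog (v ^ 3) (ymono 1 3) * dilog (v ^ 1) (ymono 0 1)))))) := by
  simp only [map_mul]
  rw [scale_dilog_ymono (k := 1) three_pos (by simp) rfl,
    scale_dilog_ymono (k := 3) one_pos (by simp) rfl,
    scale_dilog_ymono (k := 2) three_pos (by simp) rfl,
    scale_dilog_ymono (k := 3) one_pos (by simp) rfl,
    scale_dilog_ymono (k := 1) three_pos (by simp) rfl,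
    scale_dilog_ymono (k := 0) one_pos (by simp) rfl,
    ← mul_assoc scaleFactor, scaleFactor_mul_dilog]
  simp only [mul_assoc]
  rw [← mul_assoc factor₁₁, factor₁₁_mul_dilog]
  simp only [mul_assoc]
  rw [← mul_assoc factor₂₃, factor₂₃_mul_dilog]
  simp only [mul_assoc]
  rw [← mul_assoc factor₁₂, factor₁₂_mul_dilog]
  simp only [mul_assoc]
  rw [← mul_assoc factor₁₃, factor₁₃_mul_dilog]
  simp only [mul_assoc, dilogRatio, mul_one]

theorem dilog_mul_dilog :
    dilog (v ^ 1) (ymono 0 1) * dilog (v ^ 3) (ymono 1 0)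
      = dilog (v ^ 3) (ymono 1 0) * (dilog (v ^ 1) (ymono 1 1)
        * (dilog (v ^ 3) (ymono 2 3) * (dilog (v ^ 1) (ymono 1 2)
          * (dilog (v ^ 3) (ymono 1 3) * dilog (v ^ 1) (ymono 0 1))))) := by
  refine eq_of_scale_eq (c := v ^ 6) (fun m hm => ?_) ?_ scale_dilog_mul_dilog
    scale_ordered_dilog_prod ?_
  · rw [← pow_mul]
    exact v_pow_ne_one (by omega)
  · simp [scaleFactor, atZero_smul, atZero_mono]
  · simp only [map_mul, atZero_dilog_ymono _ _ one_ne_zero, atZero_dilog_ymono _ _ two_ne_zero,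
      mul_one, one_mul]

end QPlane

/-- consistency relation of the type `G₂` QCSD: in `A₃`,
`Ψ_v(Y₂)·Ψ_{v³}(Y₁) = Ψ_{v³}(Y₁)·Ψ_v(y^{(1,1)})·Ψ_{v³}(y^{(2,3)})·Ψ_v(y^{(1,2)})·
Ψ_{v³}(y^{(1,3)})·Ψ_v(Y₂)`. -/
theorem G2_consistency :
    qmul 3 (qPsi 3 v (qy 3 0 0 1)) (qPsi 3 (v ^ 3) (qy 3 0 1 0))
      = qmul 3 (qPsi 3 (v ^ 3) (qy 3 0 1 0))
          (qmul 3 (qPsi 3 v (qy 3 0 1 1))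
            (qmul 3 (qPsi 3 (v ^ 3) (qy 3 0 2 3))
              (qmul 3 (qPsi 3 v (qy 3 0 1 2))
                (qmul 3 (qPsi 3 (v ^ 3) (qy 3 0 1 3))
                  (qPsi 3 v (qy 3 0 0 1)))))) := by
  have h₀₁ := QPlane.qPsi_qy 1 (m := 0) (n := 1) (by simp)
  have h₁₁ := QPlane.qPsi_qy 1 (m := 1) (n := 1) (by simp)
  have h₁₂ := QPlane.qPsi_qy 1 (m := 1) (n := 2) (by simp)
  have h := QPlane.dilog_mul_dilog
  rw [pow_one] at h₀₁ h₁₁ h₁₂ h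
  rw [h₀₁, h₁₁, h₁₂, QPlane.qPsi_qy 3 (by simp), QPlane.qPsi_qy 3 (by simp),
    QPlane.qPsi_qy 3 (by simp)]
  exact h
end
end
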